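/- arXiv:2602.05732 — 2 statements merged into one kernel-verified Lean document; each statement's English description precedes it below -/
import Mathlib

section
/- For every natural number k, every positive integer n, and every iteration count m, T_k^[m](3^k · n) = 3^k · T_0^[m](n); that is, the T_k-trajectory of 3^k n is exactly the T_0-trajectory of n multiplied by 3^k. -/
/-- The shortcut `3n + 3^k` Collatz-type map on the natural numbers:
`T k n = (3n + 3^k)/2` for odd `n` and `n/2` for even `n`.  `T 0` is the
shortcut Collatz map. -/
def T (k : ℕ) (n : ℕ) : ℕ := if Odd n then (3 * n + 3 ^ k) / 2 else n / 2

theorem semiconj_pow_three_mul_T (k : ℕ) : Function.Semiconj (3 ^ k * ·) (T 0) (T k) := by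
  intro n
  have h3 : Odd (3 ^ k) := Odd.pow (by decide)
  by_cases h : Odd n
  · have h2 : 2 ∣ 3 * n + 1 := by
      obtain ⟨c, rfl⟩ := h
      omega
    simp only [T, Nat.odd_mul, h3, h, and_self, if_true, pow_zero]
    rw [← Nat.mul_div_assoc _ h2]
    congr 1
    ring
  · have h2 : 2 ∣ n := (Nat.not_odd_iff_even.mp h).two_dvd
    simp only [T, Nat.odd_mul, h3, h, and_false, if_false]
    exact (Nat.mul_div_assoc _ h2).symm

/-- The `T k`-trajectory of `3^k · n` is the `T 0`-trajectory of `n`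
multiplied by `3^k`. -/
theorem Tk_iterate_pow_three_mul (k n m : ℕ) (hn : 0 < n) :
    (T k)^[m] (3 ^ k * n) = 3 ^ k * (T 0)^[m] n :=
  (((semiconj_pow_three_mul_T k).iterate_right m) n).symm
end

section
/- For every natural number k and every positive integer n, there exists an iteration count m such that 3^k divides T_k^[m](n). (This holds unconditionally, without assuming the Collatz conjecture.) -/
theorem T_pos {k n : ℕ} (hn : 0 < n) : 0 < T k n := by
  have : 0 < 3 ^ k := by positivity
  unfold T
  split_ifs with h
  · omega
  · rw [Nat.not_odd_iff_even, even_iff_two_dvd] at h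
    omega

theorem iterate_T_pos {k n : ℕ} (hn : 0 < n) (m : ℕ) : 0 < (T k)^[m] n := by
  induction m with
  | zero => exact hn
  | succ m ih =>
    rw [Function.iterate_succ_apply']
    exact T_pos ih

theorem two_mul_T_of_odd {k n : ℕ} (hn : Odd n) : 2 * T k n = 3 * n + 3 ^ k := by
  have hk : Odd (3 ^ k) := Odd.pow (by decide)
  obtain ⟨a, ha⟩ := hn
  obtain ⟨b, hb⟩ := hk
  rw [T, if_pos ⟨a, ha⟩]
  omega

theorem two_mul_T_of_even {k n : ℕ} (hn : Even n) : 2 * T k n = n := by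
  rw [T, if_neg (Nat.not_odd_iff_even.mpr hn)]
  exact Nat.two_mul_div_two_of_even hn

/-- Below level `k`, some iterate gains a factor of `3`. -/
theorem exists_iterate_pow_succ_dvd {k j : ℕ} (hj : j < k) (n : ℕ) (hn : 0 < n)
    (h : 3 ^ j ∣ n) : ∃ m : ℕ, 3 ^ (j + 1) ∣ (T k)^[m] n := by
  induction n using Nat.strong_induction_on with
  | _ n ih =>
    rcases Nat.even_or_odd n with he | ho
    · have h2 := two_mul_T_of_even (k := k) he
      have hd : 3 ^ j ∣ T k n :=
        (Nat.Coprime.pow_left j (by decide : Nat.Coprime 3 2)).dvd_of_dvd_mul_left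
          (h2.symm ▸ h)
      obtain ⟨m, hm⟩ := ih (T k n) (by omega) (by omega) hd
      exact ⟨m + 1, hm⟩
    · refine ⟨1, (Nat.Coprime.pow_left (j + 1)
        (by decide : Nat.Coprime 3 2)).dvd_of_dvd_mul_left ?_⟩
      rw [Function.iterate_one, two_mul_T_of_odd ho]
      refine dvd_add ?_ (pow_dvd_pow 3 hj)
      rw [pow_succ']
      exact mul_dvd_mul_left 3 h

/-- Unconditionally, every positive integer has some `T k`-iterate divisible
by `3^k`. -/
theorem exists_iterate_pow_three_dvd (k n : ℕ) (hn : 0 < n) :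
    ∃ m : ℕ, 3 ^ k ∣ (T k)^[m] n := by
  suffices H : ∀ j ≤ k, ∃ m : ℕ, 3 ^ j ∣ (T k)^[m] n from H k le_rfl
  intro j
  induction j with
  | zero => exact fun _ => ⟨0, by simp⟩
  | succ j ih =>
    intro hj
    obtain ⟨m, hm⟩ := ih (by omega)
    obtain ⟨l, hl⟩ := exists_iterate_pow_succ_dvd hj _ (iterate_T_pos hn m) hm
    exact ⟨l + m, by rwa [Function.iterate_add_apply]⟩
end
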